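/- If C is a ζ-cycle of length L = log μ, then for any positive integer n, the n-fold cover C_n (the circle of length nL, i.e. ℝ₊*/μ^{nℤ}) is also a ζ-cycle. -/

import Mathlib

open MeasureTheory Set Complex

/-- The space `S₀^ev` of even real Schwartz functions with `f(0) = 0` and `∫ f = 0`. -/
def S0ev : Set (SchwartzMap ℝ ℝ) :=
  {f | (∀ x, f (-x) = f x) ∧ f 0 = 0 ∧ (∫ x : ℝ, f x) = 0}

/-- `Σ_μ E(f)(u) = ∑_{k∈ℤ} (μ^k u)^{1/2} ∑_{n≥1} f(n μ^k u)`. -/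
noncomputable def SigmaE (μ : ℝ) (f : SchwartzMap ℝ ℝ) (u : ℝ) : ℝ :=
  ∑' k : ℤ, Real.sqrt (μ ^ k * u) * ∑' n : ℕ, f (((n : ℝ) + 1) * (μ ^ k * u))

/-- The measure `d*u = du/u` on the fundamental domain `(1, μ]` of `ℝ₊*/μ^ℤ`;
`L²` of this measure is `L²(C)` for the circle `C = ℝ₊*/μ^ℤ` of length `log μ`. -/
noncomputable def mulHaarOn (μ : ℝ) : Measure ℝ :=
  (volume.restrict (Set.Ioc (1:ℝ) μ)).withDensity fun u => ENNReal.ofReal u⁻¹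

/-- The circle `C = ℝ₊*/μ^ℤ` is a ζ-cycle when `Σ_μ E(S₀^ev)` is not dense in `L²(C)`,
equivalently when some nonzero `g ∈ L²(C)` is orthogonal to all `Σ_μ E(f)`, `f ∈ S₀^ev`. -/
noncomputable def IsZetaCycle (μ : ℝ) : Prop :=
  ∃ g : Lp ℂ 2 (mulHaarOn μ), g ≠ 0 ∧
    ∀ f ∈ S0ev, (∫ u, (starRingEnd ℂ) (g u) * (SigmaE μ f u : ℂ) ∂(mulHaarOn μ)) = 0

noncomputable def mulHaarAll : Measure ℝ := volume.withDensity fun u => ENNReal.ofReal u⁻¹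

lemma mulHaarOn_eq (μ : ℝ) : mulHaarOn μ = mulHaarAll.restrict (Ioc 1 μ) := by
  rw [mulHaarOn, mulHaarAll, restrict_withDensity measurableSet_Ioc]

lemma mulHaarAll_scale (c : ℝ) (hc : 0 < c) :
    MeasurePreserving (fun x : ℝ => c * x) mulHaarAll mulHaarAll := by
  have hm : Measurable (fun x : ℝ => c * x) := by fun_prop
  refine ⟨hm, ?_⟩
  ext s hs
  rw [Measure.map_apply hm hs, mulHaarAll, withDensity_apply _ (hm hs), withDensity_apply _ hs]
  have h1 : ∀ u : ℝ, ENNReal.ofReal u⁻¹ = ENNReal.ofReal c * ENNReal.ofReal (c * u)⁻¹ := by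
    intro u
    rw [← ENNReal.ofReal_mul hc.le]
    congr 1
    rw [mul_inv, ← mul_assoc, mul_inv_cancel₀ hc.ne', one_mul]
  have h2 : ∫⁻ u in (fun x : ℝ => c * x) ⁻¹' s, ENNReal.ofReal u⁻¹
      = ∫⁻ u in (fun x : ℝ => c * x) ⁻¹' s, ENNReal.ofReal c * ENNReal.ofReal (c * u)⁻¹ :=
    lintegral_congr fun u => h1 u
  rw [h2, ← setLIntegral_map (f := fun u => ENNReal.ofReal c * ENNReal.ofReal u⁻¹) hs
    (by fun_prop) hm, Real.map_volume_mul_left hc.ne', Measure.restrict_smul,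
    lintegral_smul_measure, lintegral_const_mul _ (by fun_prop), smul_eq_mul, ← mul_assoc,
    ← ENNReal.ofReal_mul (abs_nonneg _), abs_of_pos (inv_pos.2 hc), inv_mul_cancel₀ hc.ne']
  simp

lemma mulHaarAll_scale_restrict (c a b : ℝ) (hc : 0 < c) :
    MeasurePreserving (fun x : ℝ => c * x) (mulHaarAll.restrict (Ioc a b))
      (mulHaarAll.restrict (Ioc (c * a) (c * b))) := by
  have := (mulHaarAll_scale c hc).restrict_preimage
    (measurableSet_Ioc (a := c * a) (b := c * b))
  convert this using 2
  ext x
  simp only [mem_preimage, mem_Ioc, mul_lt_mul_iff_right₀ hc, mul_le_mul_iff_right₀ hc]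

lemma mulHaarOn_finite (μ : ℝ) : IsFiniteMeasure (mulHaarOn μ) := by
  unfold mulHaarOn
  refine isFiniteMeasure_withDensity_ofReal (Integrable.hasFiniteIntegral ?_)
  have : IntegrableOn (fun u : ℝ => u⁻¹) (Icc 1 μ) := by
    apply ContinuousOn.integrableOn_Icc
    apply continuousOn_inv₀.mono
    intro x hx
    simp only [mem_compl_iff, mem_singleton_iff]
    linarith [hx.1] 
  exact this.mono_set Ioc_subset_Icc_self

/-- The function `E(f)`. -/
noncomputable def EE (f : SchwartzMap ℝ ℝ) (v : ℝ) : ℝ :=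
  Real.sqrt v * ∑' n : ℕ, f (((n : ℝ) + 1) * v)

lemma schwartz_bd (f : SchwartzMap ℝ ℝ) : ∃ K, 0 < K ∧ ∀ x : ℝ, x ^ 2 * |f x| ≤ K := by
  obtain ⟨K, hK, h⟩ := f.decay 2 0
  refine ⟨K, hK, fun x => ?_⟩
  simpa using h x

lemma inner_bd (f : SchwartzMap ℝ ℝ) : ∃ K, 0 < K ∧ ∀ v : ℝ, v ≠ 0 → ∀ n : ℕ,
    ‖f (((n : ℝ) + 1) * v)‖ ≤ K / v ^ 2 * (1 / ((n : ℝ) + 1) ^ 2) := by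
  obtain ⟨K, hK, h⟩ := schwartz_bd f
  refine ⟨K, hK, fun v hv n => ?_⟩
  have := h (((n : ℝ) + 1) * v)
  have hn : (0 : ℝ) < (n : ℝ) + 1 := by positivity
  have hv2 : 0 < v ^ 2 := by positivity
  rw [Real.norm_eq_abs, div_mul_div_comm, mul_one, le_div_iff₀ (by positivity)]
  nlinarith

lemma summable_sq : Summable (fun n : ℕ => 1 / ((n : ℝ) + 1) ^ 2) := by
  have := (summable_nat_add_iff 1).2 (Real.summable_one_div_nat_pow.2 (le_refl 2))
  simpa using this

lemma inner_summable (f : SchwartzMap ℝ ℝ) (h0 : f 0 = 0) (v : ℝ) :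
    Summable (fun n : ℕ => f (((n : ℝ) + 1) * v)) := by
  by_cases hv : v = 0
  · subst hv
    simpa [h0] using summable_zero
  · obtain ⟨K, hK, h⟩ := inner_bd f
    exact Summable.of_norm_bounded (summable_sq.mul_left _) (h v hv)

lemma inner_bound1 (f : SchwartzMap ℝ ℝ) : ∃ B, 0 ≤ B ∧ ∀ v : ℝ, 0 < v →
    |∑' n : ℕ, f (((n : ℝ) + 1) * v)| ≤ B / v ^ 2 := by
  obtain ⟨K, hK, h⟩ := inner_bd f
  refine ⟨K * ∑' n : ℕ, 1 / ((n : ℝ) + 1) ^ 2, by positivity, fun v hv => ?_⟩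
  have := tsum_of_norm_bounded (summable_sq.mul_left (K / v ^ 2)).hasSum (h v hv.ne')
  rw [tsum_mul_left] at this
  rw [Real.norm_eq_abs] at this
  refine this.trans (le_of_eq ?_)
  ring

lemma riemann_step (f : SchwartzMap ℝ ℝ) (a v : ℝ) (hv : 0 < v) :
    |v * f (a + v) - ∫ x in a..(a + v), f x| ≤ v * ∫ x in a..(a + v), |deriv f x| := by
  have hd : Continuous (deriv f) := (SchwartzMap.derivCLM ℝ ℝ f).continuous
  have hle : a ≤ a + v := by linarith
  have h1 : v * f (a + v) - ∫ x in a..(a + v), f x = ∫ x in a..(a + v), (f (a + v) - f x) := by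
    rw [intervalIntegral.integral_sub (by simp) (f.continuous.intervalIntegrable _ _)]
    simp
  rw [h1, ← Real.norm_eq_abs]
  have h2 := intervalIntegral.norm_integral_le_of_norm_le_const (a := a) (b := a + v)
    (f := fun x => f (a + v) - f x) (C := ∫ x in a..(a + v), |deriv f x|) ?_
  · rw [add_sub_cancel_left, abs_of_pos hv] at h2
    linarith
  · intro x hx
    rw [uIoc_of_le hle] at hx
    have h3 : ∫ y in x..(a + v), deriv f y = f (a + v) - f x :=
      intervalIntegral.integral_deriv_eq_sub (fun y _ => f.differentiableAt)
        (hd.intervalIntegrable _ _)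
    rw [← h3]
    refine (intervalIntegral.norm_integral_le_integral_norm hx.2).trans ?_
    refine intervalIntegral.integral_mono_interval hx.1.le hx.2 le_rfl ?_ 
      (hd.norm.intervalIntegrable _ _)
    exact Filter.Eventually.of_forall fun y => norm_nonneg _

lemma riemann_sum (f : SchwartzMap ℝ ℝ) (v : ℝ) (hv : 0 < v) (N : ℕ) :
    |v * (∑ n ∈ Finset.range N, f (((n : ℝ) + 1) * v)) - ∫ x in (0 : ℝ)..(N * v), f x|
      ≤ v * ∫ x in (0 : ℝ)..(N * v), |deriv f x| := by
  have hd : Continuous (deriv f) := (SchwartzMap.derivCLM ℝ ℝ f).continuous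
  induction N with
  | zero => simp
  | succ N ih =>
    have h := riemann_step f (N * v) v hv
    have e : (N : ℝ) * v + v = ((N + 1 : ℕ) : ℝ) * v := by push_cast; ring
    rw [e] at h
    rw [Finset.sum_range_succ, ← intervalIntegral.integral_add_adjacent_intervals
      (f.continuous.intervalIntegrable 0 (N * v))
      (f.continuous.intervalIntegrable (N * v) ((N + 1 : ℕ) * v)),
      ← intervalIntegral.integral_add_adjacent_intervals
      (hd.abs.intervalIntegrable 0 (N * v))
      (hd.abs.intervalIntegrable (N * v) ((N + 1 : ℕ) * v))]
    push_cast at h ⊢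
    rw [abs_le] at *
    constructor <;> linarith [h.1, h.2, ih.1, ih.2]

lemma inner_bound2 (f : SchwartzMap ℝ ℝ) (hf : f ∈ S0ev) : ∃ A, 0 ≤ A ∧ ∀ v : ℝ, 0 < v →
    |∑' n : ℕ, f (((n : ℝ) + 1) * v)| ≤ A := by
  have hdi : Integrable (deriv f) := (SchwartzMap.derivCLM ℝ ℝ f).integrable
  refine ⟨∫ x in Ioi (0 : ℝ), |deriv f x|, integral_nonneg fun _ => abs_nonneg _, fun v hv => ?_⟩
  have hint : ∫ x in Ioi (0 : ℝ), f x = 0 := by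
    have h1 := integral_comp_abs (f := f)
    have h2 : ∀ x : ℝ, f |x| = f x := by
      intro x
      rcases abs_choice x with h | h <;> rw [h]
      exact hf.1 x
    simp only [h2, hf.2.2] at h1
    linarith
  have hN : Filter.Tendsto (fun N : ℕ => (N : ℝ) * v) Filter.atTop Filter.atTop :=
    tendsto_natCast_atTop_atTop.atTop_mul_const hv
  have t1 := intervalIntegral_tendsto_integral_Ioi 0 (f.integrable (μ := volume)).integrableOn hN
  have t2 := intervalIntegral_tendsto_integral_Ioi 0 hdi.abs.integrableOn hN
  have t3 := (inner_summable f hf.2.1 v).hasSum.tendsto_sum_nat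
  have := le_of_tendsto_of_tendsto' ((t3.const_mul v).sub t1).abs (t2.const_mul v)
    (riemann_sum f v hv)
  rw [hint, sub_zero, abs_mul, abs_of_pos hv] at this
  exact le_of_mul_le_mul_left this hv

lemma EE_bound (f : SchwartzMap ℝ ℝ) (hf : f ∈ S0ev) : ∃ C, 0 ≤ C ∧ ∀ v : ℝ, 0 < v →
    |EE f v| ≤ C * √v ∧ |EE f v| ≤ C * (√v)⁻¹ := by
  obtain ⟨A, hA, h2⟩ := inner_bound2 f hf
  obtain ⟨B, hB, h1⟩ := inner_bound1 f
  refine ⟨A + B, by positivity, fun v hv => ?_⟩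
  have hs : 0 < √v := Real.sqrt_pos.2 hv
  have hss : √v * √v = v := Real.mul_self_sqrt hv.le
  have a1 := h1 v hv
  have a2 := h2 v hv
  rw [EE, abs_mul, abs_of_pos hs]
  set T := |∑' n : ℕ, f (((n : ℝ) + 1) * v)|
  constructor
  · nlinarith
  · have : T * v ≤ A + B := by
      rw [le_div_iff₀ (by positivity)] at a1
      have hT : 0 ≤ T := abs_nonneg _
      rcases le_total v 1 with h | h <;> nlinarith
    rw [← div_eq_mul_inv, le_div_iff₀ hs]
    calc √v * T * √v = T * (√v * √v) := by ring
      _ ≤ _ := by rw [hss]; exact this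

lemma EE_zero (f : SchwartzMap ℝ ℝ) (v : ℝ) (hv : v ≤ 0) : EE f v = 0 := by
  rw [EE, Real.sqrt_eq_zero_of_nonpos hv, zero_mul]

lemma geom_summable (r : ℝ) (hr : 1 < r) : Summable (fun k : ℤ => (r⁻¹) ^ k.natAbs) := by
  have := summable_geometric_of_lt_one (by positivity) (inv_lt_one_of_one_lt₀ hr)
  apply Summable.of_nat_of_neg <;> simpa using this

lemma EE_term (f : SchwartzMap ℝ ℝ) (hf : f ∈ S0ev) : ∃ C, 0 ≤ C ∧ ∀ μ : ℝ, 1 < μ →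
    ∀ w : ℝ, 0 < w → ∀ k : ℤ, ‖EE f (μ ^ k * w)‖ ≤ C * (√w + (√w)⁻¹) * ((√μ)⁻¹) ^ k.natAbs := by
  obtain ⟨C, hC, h⟩ := EE_bound f hf
  refine ⟨C, hC, fun μ hμ w hw k => ?_⟩
  have hμ0 : 0 < μ := by linarith
  have hs : 0 < √w := Real.sqrt_pos.2 hw
  have hr : 0 < √μ := Real.sqrt_pos.2 hμ0
  obtain ⟨b1, b2⟩ := h (μ ^ k * w) (by positivity)
  rw [Real.norm_eq_abs]
  have hp : ∀ m : ℕ, √(μ ^ m) = √μ ^ m := fun m => by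
    rw [Real.sqrt_eq_iff_mul_self_eq (by positivity) (by positivity), ← mul_pow,
      Real.mul_self_sqrt hμ0.le]
  obtain ⟨m, rfl | rfl⟩ := Int.eq_nat_or_neg k
  · refine b2.trans ?_
    rw [zpow_natCast, Real.sqrt_mul (by positivity), hp, mul_inv, Int.natAbs_natCast, inv_pow,
      mul_assoc]
    refine mul_le_mul_of_nonneg_left ?_ hC
    rw [mul_comm]
    exact mul_le_mul_of_nonneg_right (by linarith) (by positivity)
  · refine b1.trans ?_
    rw [zpow_neg, zpow_natCast, Real.sqrt_mul (by positivity), Real.sqrt_inv, hp, Int.natAbs_neg,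
      Int.natAbs_natCast, inv_pow, mul_assoc]
    refine mul_le_mul_of_nonneg_left ?_ hC
    rw [mul_comm]
    have : 0 < (√w)⁻¹ := by positivity
    exact mul_le_mul_of_nonneg_right (by linarith) (by positivity)

lemma EE_summable (f : SchwartzMap ℝ ℝ) (hf : f ∈ S0ev) (μ : ℝ) (hμ : 1 < μ) (w : ℝ) :
    Summable (fun k : ℤ => EE f (μ ^ k * w)) := by
  rcases le_or_gt w 0 with hw | hw
  · have : ∀ k : ℤ, EE f (μ ^ k * w) = 0 := fun k =>
      EE_zero f _ (mul_nonpos_of_nonneg_of_nonpos (zpow_nonneg (by linarith) _) hw)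
    simpa [this] using summable_zero
  · obtain ⟨C, hC, h⟩ := EE_term f hf
    exact Summable.of_norm_bounded ((geom_summable _ (Real.lt_sqrt_of_sq_lt (by simpa))).mul_left _)
      (h μ hμ w hw)

lemma SigmaE_eq (μ : ℝ) (f : SchwartzMap ℝ ℝ) (u : ℝ) :
    SigmaE μ f u = ∑' k : ℤ, EE f (μ ^ k * u) := rfl

lemma SigmaE_bound (f : SchwartzMap ℝ ℝ) (hf : f ∈ S0ev) (μ : ℝ) (hμ : 1 < μ) (M : ℝ) :
    ∃ D, ∀ w : ℝ, 1 ≤ w → w ≤ M → |SigmaE μ f w| ≤ D := by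
  obtain ⟨C, hC, h⟩ := EE_term f hf
  have hg := geom_summable _ (Real.lt_sqrt_of_sq_lt (by simpa) : 1 < √μ)
  refine ⟨C * (√M + 1) * ∑' k : ℤ, ((√μ)⁻¹) ^ k.natAbs, fun w h1 h2 => ?_⟩
  have := tsum_of_norm_bounded (hg.mul_left (C * (√w + (√w)⁻¹))).hasSum
    (h μ hμ w (by linarith))
  rw [tsum_mul_left, Real.norm_eq_abs, ← SigmaE_eq] at this
  refine this.trans ?_
  have a1 : √w ≤ √M := Real.sqrt_le_sqrt h2
  have a2 : (√w)⁻¹ ≤ 1 := inv_le_one_of_one_le₀ (Real.one_le_sqrt.2 h1)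
  gcongr

lemma measurable_tsum_real {ι : Type*} [Countable ι] (F : ι → ℝ → ℝ) (hF : ∀ i, Measurable (F i))
    (hs : ∀ x, Summable (fun i => F i x)) : Measurable (fun x => ∑' i, F i x) := by
  refine measurable_of_tendsto_metrizable' (Filter.atTop : Filter (Finset ι))
    (f := fun s x => ∑ i ∈ s, F i x) (fun s => Finset.measurable_fun_sum s fun i _ => hF i) ?_
  rw [tendsto_pi_nhds]
  intro x
  exact (hs x).hasSum

lemma SigmaE_measurable (f : SchwartzMap ℝ ℝ) (hf : f ∈ S0ev) (μ : ℝ) (hμ : 1 < μ) :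
    Measurable (SigmaE μ f) := by
  have h1 : Measurable (EE f) := by
    unfold EE
    refine Real.continuous_sqrt.measurable.mul (measurable_tsum_real _ (fun n => ?_)
      (inner_summable f hf.2.1))
    exact f.continuous.measurable.comp (by fun_prop)
  exact measurable_tsum_real _ (fun k => h1.comp (by fun_prop)) (EE_summable f hf μ hμ)

lemma SigmaE_cover (f : SchwartzMap ℝ ℝ) (hf : f ∈ S0ev) (μ : ℝ) (hμ : 1 < μ) (n : ℕ)
    (hn : 0 < n) (u : ℝ) :
    ∑ j ∈ Finset.range n, SigmaE (μ ^ n) f (μ ^ j * u) = SigmaE μ f u := by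
  have : NeZero n := ⟨hn.ne'⟩
  have hs := EE_summable f hf μ hμ u
  rw [SigmaE_eq μ, ← (Int.divModEquiv n).symm.tsum_eq]
  have hs' := (Int.divModEquiv n).symm.summable_iff.2 hs
  have hs2 : Summable (fun c : Fin n × ℤ => EE f (μ ^ (Int.divModEquiv n).symm
      ((Equiv.prodComm (Fin n) ℤ) c) * u)) := (Equiv.prodComm (Fin n) ℤ).summable_iff.2 hs'
  rw [← (Equiv.prodComm (Fin n) ℤ).tsum_eq, Summable.tsum_prod hs2, tsum_fintype,
    Finset.sum_range]
  refine Finset.sum_congr rfl fun j _ => ?_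
  rw [SigmaE_eq]
  refine tsum_congr fun k => ?_
  have hμ0 : μ ≠ 0 := by linarith
  simp only [Equiv.prodComm_apply, Prod.swap_prod_mk, Int.divModEquiv_symm_apply]
  rw [zpow_add₀ hμ0, zpow_natCast, ← mul_assoc, mul_comm k, zpow_mul, zpow_natCast]

/-- ζ-cycles are stable under finite covers: if `C = ℝ₊*/μ^ℤ` is a ζ-cycle,
then so is its `n`-fold cover `ℝ₊*/μ^{nℤ}` for every positive integer `n`. -/
theorem stmt10 (μ : ℝ) (hμ : 1 < μ) (h : IsZetaCycle μ) (n : ℕ) (hn : 0 < n) :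
    IsZetaCycle (μ ^ n) := by
  classical
  obtain ⟨g, hg0, hg⟩ := h
  have hμ0 : 0 < μ := by linarith
  have hfin := mulHaarOn_finite μ
  -- measure preserving maps between pieces
  have hpow : ∀ j : ℕ, 0 < μ ^ j := fun j => by positivity
  let I : ℕ → Set ℝ := fun j => Ioc (μ ^ j) (μ ^ (j + 1))
  have mp : ∀ j : ℕ, MeasurePreserving (fun x : ℝ => μ ^ j * x) (mulHaarOn μ)
      (mulHaarAll.restrict (I j)) := by
    intro j
    have := mulHaarAll_scale_restrict (μ ^ j) 1 μ (hpow j)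
    rw [mul_one, ← pow_succ, ← mulHaarOn_eq] at this
    exact this
  have mp' : ∀ j : ℕ, MeasurePreserving (fun x : ℝ => (μ ^ j)⁻¹ * x)
      (mulHaarAll.restrict (I j)) (mulHaarOn μ) := by
    intro j
    have := mulHaarAll_scale_restrict (μ ^ j)⁻¹ (μ ^ j) (μ ^ (j + 1)) (inv_pos.2 (hpow j))
    rw [inv_mul_cancel₀ (hpow j).ne', pow_succ, inv_mul_cancel_left₀ (hpow j).ne',
      ← mulHaarOn_eq, ← pow_succ] at this
    exact this
  have hemb : ∀ j : ℕ, MeasurableEmbedding (fun x : ℝ => μ ^ j * x) := fun j =>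
    (Homeomorph.mulLeft₀ (μ ^ j) (hpow j).ne').measurableEmbedding
  have hIsub : ∀ j ∈ Finset.range n, I j ⊆ Ioc 1 (μ ^ n) := by
    intro j hj
    exact Ioc_subset_Ioc (one_le_pow₀ hμ.le)
      (pow_le_pow_right₀ hμ.le (Finset.mem_range.1 hj))
  have hres : ∀ j ∈ Finset.range n, (mulHaarOn (μ ^ n)).restrict (I j)
      = mulHaarAll.restrict (I j) := by
    intro j hj
    rw [mulHaarOn_eq, Measure.restrict_restrict measurableSet_Ioc,
      inter_eq_self_of_subset_left (hIsub j hj)]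
  let G : ℝ → ℂ := fun u => ∑ j ∈ Finset.range n, (I j).indicator (fun x => g ((μ ^ j)⁻¹ * x)) u
  have hG : MemLp G 2 (mulHaarOn (μ ^ n)) := by
    refine memLp_finsetSum _ fun j hj => ?_
    rw [memLp_indicator_iff_restrict measurableSet_Ioc, hres j hj]
    exact (Lp.memLp g).comp_measurePreserving (mp' j)
  refine ⟨hG.toLp G, ?_, ?_⟩
  · intro h0
    apply hg0
    have e1 : G =ᵐ[mulHaarOn (μ ^ n)] 0 := by
      have := hG.coeFn_toLp
      rw [h0] at this
      exact this.symm.trans (Lp.coeFn_zero _ _ _)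
    rw [mulHaarOn_eq] at e1
    have hsub : Ioc 1 μ ⊆ Ioc 1 (μ ^ n) :=
      Ioc_subset_Ioc le_rfl (le_self_pow₀ hμ.le hn.ne')
    have e2 : G =ᵐ[mulHaarOn μ] 0 := by
      rw [mulHaarOn_eq]
      exact ae_restrict_of_ae_restrict_of_subset hsub e1
    have e3 : ∀ᵐ u ∂(mulHaarOn μ), u ∈ Ioc 1 μ := by
      rw [mulHaarOn_eq]
      exact ae_restrict_mem measurableSet_Ioc
    rw [Lp.eq_zero_iff_ae_eq_zero]
    filter_upwards [e2, e3] with u hu hmem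
    have : G u = g u := by
      change ∑ j ∈ Finset.range n, _ = _
      rw [Finset.sum_eq_single_of_mem 0 (Finset.mem_range.2 hn)]
      · simp [I, indicator_of_mem, hmem.1, hmem.2]
      · intro j _ hj
        refine indicator_of_notMem (fun hc => ?_) _
        have : μ ≤ μ ^ j := le_self_pow₀ hμ.le hj
        exact absurd hc.1 (not_lt.2 (hmem.2.trans this))
    rw [← this]
    exact hu
  · intro f hf
    have hμn : 1 < μ ^ n := one_lt_pow₀ hμ hn.ne'
    set S := SigmaE (μ ^ n) f with hS
    have hSm : Measurable S := SigmaE_measurable f hf _ hμn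
    -- integrability on the base
    have int1 : ∀ j : ℕ, Integrable (fun u => (starRingEnd ℂ) (g u) * (S (μ ^ j * u) : ℂ))
        (mulHaarOn μ) := by
      intro j
      have hgi : Integrable (fun u => (starRingEnd ℂ) (g u)) (mulHaarOn μ) := by
        have h1 : Integrable g (mulHaarOn μ) := (Lp.memLp g).integrable (by norm_num)
        exact (LinearIsometryEquiv.integrable_comp_iff conjLIE).2 h1
      obtain ⟨D, hD⟩ := SigmaE_bound f hf (μ ^ n) hμn (μ ^ j * μ)
      have hb := hgi.bdd_mul (f := fun u => (S (μ ^ j * u) : ℂ)) (c := D)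
        (by
          apply Measurable.aestronglyMeasurable
          exact Complex.measurable_ofReal.comp (hSm.comp (by fun_prop)))
        (by
          rw [mulHaarOn_eq]
          filter_upwards [ae_restrict_mem measurableSet_Ioc] with u hu
          rw [Complex.norm_real, Real.norm_eq_abs]
          have : 1 ≤ μ ^ j := one_le_pow₀ hμ.le
          exact hD _ (one_le_mul_of_one_le_of_one_le this hu.1.le)
            (mul_le_mul_of_nonneg_left hu.2 (hpow j).le))
      simpa only [mul_comm] using hb
    let H : ℕ → ℝ → ℂ := fun j x => (starRingEnd ℂ) (g ((μ ^ j)⁻¹ * x)) * (S x : ℂ)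
    have hHcomp : ∀ j u, H j (μ ^ j * u) = (starRingEnd ℂ) (g u) * (S (μ ^ j * u) : ℂ) := by
      intro j u
      simp only [H]
      rw [inv_mul_cancel_left₀ (hpow j).ne']
    have int2 : ∀ j, Integrable (H j) (mulHaarAll.restrict (I j)) := by
      intro j
      rw [← (mp j).integrable_comp_emb (hemb j)]
      exact (int1 j).congr (Filter.Eventually.of_forall fun u => (hHcomp j u).symm)
    have eqn : ∀ u, (starRingEnd ℂ) (G u) * (S u : ℂ)
        = ∑ j ∈ Finset.range n, (I j).indicator (H j) u := by
      intro u
      simp only [G]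
      rw [map_sum, Finset.sum_mul]
      refine Finset.sum_congr rfl fun j _ => ?_
      by_cases hu : u ∈ I j <;> simp [hu, H]
    calc ∫ u, (starRingEnd ℂ) (hG.toLp G u) * (S u : ℂ) ∂(mulHaarOn (μ ^ n))
        = ∫ u, ∑ j ∈ Finset.range n, (I j).indicator (H j) u ∂(mulHaarOn (μ ^ n)) := by
          refine integral_congr_ae ?_
          filter_upwards [hG.coeFn_toLp] with u hu
          rw [hu, eqn]
      _ = ∑ j ∈ Finset.range n, ∫ u, (I j).indicator (H j) u ∂(mulHaarOn (μ ^ n)) := by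
          refine integral_finsetSum _ fun j hj => ?_
          rw [integrable_indicator_iff measurableSet_Ioc, IntegrableOn, hres j hj]
          exact int2 j
      _ = ∑ j ∈ Finset.range n, ∫ u, (starRingEnd ℂ) (g u) * (S (μ ^ j * u) : ℂ)
            ∂(mulHaarOn μ) := by
          refine Finset.sum_congr rfl fun j hj => ?_
          rw [integral_indicator measurableSet_Ioc, hres j hj,
            ← (mp j).integral_comp (hemb j)]
          exact integral_congr_ae (Filter.Eventually.of_forall fun u => hHcomp j u)
      _ = ∫ u, ∑ j ∈ Finset.range n, (starRingEnd ℂ) (g u) * (S (μ ^ j * u) : ℂ)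
            ∂(mulHaarOn μ) := (integral_finsetSum _ fun j _ => int1 j).symm
      _ = ∫ u, (starRingEnd ℂ) (g u) * (SigmaE μ f u : ℂ) ∂(mulHaarOn μ) := by
          refine integral_congr_ae (Filter.Eventually.of_forall fun u => ?_)
          simp only
          rw [← Finset.mul_sum, ← SigmaE_cover f hf μ hμ n hn u]
          push_cast
          rfl
      _ = 0 := hg f hf
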